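/- arXiv:1505.06267 — 2 statements merged into one kernel-verified Lean document; each statement's English description precedes it below -/
import Mathlib

section
/- Let t ∈ ℂ with Re t > 0, λ = −t², and let V : ℝ → ℂ be continuous. Let μ₊, μ₋ : ℝ → ℂ be twice continuously differentiable solutions of μ'' + (λ − V(x))μ = 0 on ℝ satisfying (μ₊(x), μ₊'(x))e^{tx} → (1, −t) as x → +∞ and (μ₋(x), μ₋'(x))e^{−tx} → (1, t) as x → −∞, such that y ↦ e^{±ty}V(y)μ₊(y) and y ↦ e^{±ty}V(y)μ₋(y) are integrable on ℝ and on all the required half-lines, and such that μ₊ and μ₋ satisfy the integral equations μ₊(x) = e^{−tx} − (1/(2t))∫_x^∞ e^{−t(y−x)}V(y)μ₊(y) dy + (1/(2t))∫_x^∞ e^{t(y−x)}V(y)μ₊(y) dy and μ₋(x) = e^{tx} + (1/(2t))∫_{−∞}^x e^{−t(y−x)}V(y)μ₋(y) dy − (1/(2t))∫_{−∞}^x e^{t(y−x)}V(y)μ₋(y) dy for all x. Let E(λ) = μ₊(0)μ₋'(0) − μ₊'(0)μ₋(0) be the Evans function. Then 𝔻(λ, μ₊, μ₋) = E(λ)²/(2t).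 -/
open MeasureTheory Set Filter

/-- `D t V μ x = μ(x) + (1/(2t)) ∫_x^∞ e^{-t(y-x)} V(y) μ(y) dy
    + (1/(2t)) ∫_{-∞}^x e^{t(y-x)} V(y) μ(y) dy`, where `t = √(-λ)`. -/
noncomputable def D (t : ℂ) (V μ : ℝ → ℂ) (x : ℝ) : ℂ :=
  μ x + (1 / (2 * t)) * (∫ y in Ici x, Complex.exp (-t * ((y : ℂ) - (x : ℂ))) * V y * μ y)
      + (1 / (2 * t)) * (∫ y in Iic x, Complex.exp (t * ((y : ℂ) - (x : ℂ))) * V y * μ y)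

/-- `𝔻(λ, μ₁, μ₂) = D(0,λ,μ₁) D'(0,λ,μ₂) - D'(0,λ,μ₁) D(0,λ,μ₂)`. -/
noncomputable def DD (t : ℂ) (V μ₁ μ₂ : ℝ → ℂ) : ℂ :=
  D t V μ₁ 0 * deriv (D t V μ₂) 0 - deriv (D t V μ₁) 0 * D t V μ₂ 0

lemma setIntegral_exp_mul_sub (s : ℂ) (V μ : ℝ → ℂ) (x : ℝ) (S : Set ℝ) :
    ∫ y in S, Complex.exp (s * ((y : ℂ) - (x : ℂ))) * V y * μ y
      = Complex.exp (-s * x) * ∫ y in S, Complex.exp (s * y) * V y * μ y := by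
  rw [← integral_const_mul]
  congr 1
  ext y
  rw [show s * ((y : ℂ) - x) = -s * x + s * y by ring, Complex.exp_add]
  ring

lemma setIntegral_Ici_add_Iic {f : ℝ → ℂ} (hf : Integrable f) (x : ℝ) :
    (∫ y in Ici x, f y) + ∫ y in Iic x, f y = ∫ y, f y := by
  rw [integral_Ici_eq_integral_Ioi, add_comm]
  exact intervalIntegral.integral_Iic_add_Ioi hf.integrableOn hf.integrableOn

lemma norm_setIntegral_le_integral_norm {f : ℝ → ℂ} (hf : Integrable f) (S : Set ℝ) :
    ‖∫ y in S, f y‖ ≤ ∫ y, ‖f y‖ :=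
  (norm_integral_le_integral_norm _).trans
    (setIntegral_le_integral hf.norm (ae_of_all _ fun _ => norm_nonneg _))

lemma hasDerivAt_exp_mul_ofReal (s : ℂ) (x : ℝ) :
    HasDerivAt (fun y : ℝ => Complex.exp (s * y)) (Complex.exp (s * x) * s) x := by
  have h : HasDerivAt (fun y : ℝ => s * (y : ℂ)) s x := by
    simpa using (Complex.ofRealCLM.hasDerivAt (x := x)).const_mul s
  exact h.cexp

lemma hasDerivAt_deriv_of_contDiff_two {μ : ℝ → ℂ} (hμ : ContDiff ℝ 2 μ) (x : ℝ) :
    HasDerivAt (deriv μ) (deriv (deriv μ) x) x :=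
  ((contDiff_succ_iff_deriv (n := 1)).1 hμ).2.2.differentiable one_ne_zero |>.differentiableAt
    |>.hasDerivAt

lemma hasDerivAt_of_contDiff_two {μ : ℝ → ℂ} (hμ : ContDiff ℝ 2 μ) (x : ℝ) :
    HasDerivAt μ (deriv μ x) x :=
  (hμ.differentiable two_ne_zero).differentiableAt.hasDerivAt

/-- The Wronskian of two solutions of `μ'' + (lam - V) μ = 0` is constant. -/
lemma wronskian_eq_wronskian_zero {lam : ℂ} {V μ ν : ℝ → ℂ}
    (hμ : ContDiff ℝ 2 μ) (hν : ContDiff ℝ 2 ν)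
    (hodeμ : ∀ x, deriv (deriv μ) x + (lam - V x) * μ x = 0)
    (hodeν : ∀ x, deriv (deriv ν) x + (lam - V x) * ν x = 0) (x : ℝ) :
    μ x * deriv ν x - deriv μ x * ν x = μ 0 * deriv ν 0 - deriv μ 0 * ν 0 := by
  have h : ∀ x, HasDerivAt (fun x => μ x * deriv ν x - deriv μ x * ν x) 0 x := fun x => by
    refine (((hasDerivAt_of_contDiff_two hμ x).mul (hasDerivAt_deriv_of_contDiff_two hν x)).sub
      ((hasDerivAt_deriv_of_contDiff_two hμ x).mul
        (hasDerivAt_of_contDiff_two hν x))).congr_deriv ?_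
    linear_combination μ x * hodeν x - ν x * hodeμ x
  exact is_const_of_deriv_eq_zero (fun x => (h x).differentiableAt) (fun x => (h x).deriv) x 0

lemma hasDerivAt_exp_mul_deriv_sub {lam s : ℂ} {V μ : ℝ → ℂ} (hs : lam = -s ^ 2)
    (hμ : ContDiff ℝ 2 μ) (hode : ∀ x, deriv (deriv μ) x + (lam - V x) * μ x = 0) (x : ℝ) :
    HasDerivAt (fun x : ℝ => Complex.exp (s * x) * (deriv μ x - s * μ x))
      (Complex.exp (s * x) * V x * μ x) x := by
  refine ((hasDerivAt_exp_mul_ofReal s x).mul ((hasDerivAt_deriv_of_contDiff_two hμ x).sub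
    ((hasDerivAt_of_contDiff_two hμ x).const_mul s))).congr_deriv ?_
  subst hs
  simp only [Pi.sub_apply]
  linear_combination Complex.exp (s * x) * hode x

lemma norm_exp_mul_ofReal_le_one {s : ℂ} {x : ℝ} (h : s.re * x ≤ 0) :
    ‖Complex.exp (s * x)‖ ≤ 1 := by
  rw [Complex.norm_exp]
  simpa using h

/-- A bound for `μ` on a half-line from its variation-of-constants representation. -/
lemma norm_mul_exp_le {s c d : ℂ} {V μ : ℝ → ℂ} {x : ℝ} (S : Set ℝ) (hx : s.re * x ≤ 0)
    (hp : Integrable (fun y : ℝ => Complex.exp (s * y) * V y * μ y))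
    (hm : Integrable (fun y : ℝ => Complex.exp (-s * y) * V y * μ y))
    (heq : μ x = Complex.exp (-s * x)
      + c * (∫ y in S, Complex.exp (-s * ((y : ℂ) - (x : ℂ))) * V y * μ y)
      + d * (∫ y in S, Complex.exp (s * ((y : ℂ) - (x : ℂ))) * V y * μ y)) :
    ‖μ x * Complex.exp (s * x)‖ ≤ 1
      + ‖c‖ * (∫ y : ℝ, ‖Complex.exp (-s * y) * V y * μ y‖)
      + ‖d‖ * (∫ y : ℝ, ‖Complex.exp (s * y) * V y * μ y‖) := by
  rw [setIntegral_exp_mul_sub, setIntegral_exp_mul_sub, neg_neg] at heq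
  have he : Complex.exp (-s * x) * Complex.exp (s * x) = 1 := by
    rw [← Complex.exp_add]; simp
  have h1 : μ x * Complex.exp (s * x) = 1
      + c * ((Complex.exp (s * x) * Complex.exp (s * x)) *
        ∫ y in S, Complex.exp (-s * y) * V y * μ y)
      + d * ∫ y in S, Complex.exp (s * y) * V y * μ y := by
    rw [heq]
    linear_combination (1 + d * ∫ y in S, Complex.exp (s * y) * V y * μ y) * he
  have h2 : ‖Complex.exp (s * x) * Complex.exp (s * x)‖ ≤ 1 := by
    rw [norm_mul]
    exact mul_le_one₀ (norm_exp_mul_ofReal_le_one hx) (norm_nonneg _)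
      (norm_exp_mul_ofReal_le_one hx)
  rw [h1]
  refine (norm_add₃_le).trans ?_
  rw [norm_one, norm_mul c, norm_mul d, norm_mul (_ * _)]
  gcongr
  · exact (mul_le_of_le_one_left (norm_nonneg _) h2).trans
      (norm_setIntegral_le_integral_norm hm S)
  · exact norm_setIntegral_le_integral_norm hp S

/-- If `ν ~ exp (s x)` along `l` in the `C¹` sense and `μ exp (s x)` stays bounded, then the
Wronskian of `μ` and `ν` is minus the limit of `exp (s x) (μ' - s μ)`. -/
lemma wronskian_eq_neg_of_tendsto {l : Filter ℝ} [l.NeBot] {s L W : ℂ} {C : ℝ} {μ ν : ℝ → ℂ}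
    (hW : ∀ x, μ x * deriv ν x - deriv μ x * ν x = W)
    (hν : Tendsto (fun x : ℝ => ν x * Complex.exp (-s * x)) l (nhds 1))
    (hν' : Tendsto (fun x : ℝ => deriv ν x * Complex.exp (-s * x)) l (nhds s))
    (hL : Tendsto (fun x : ℝ => Complex.exp (s * x) * (deriv μ x - s * μ x)) l (nhds L))
    (hC : ∀ᶠ x : ℝ in l, ‖μ x * Complex.exp (s * x)‖ ≤ C) : W = -L := by
  have h0 : Tendsto (fun x : ℝ => deriv ν x * Complex.exp (-s * x)
      - s * (ν x * Complex.exp (-s * x))) l (nhds 0) := by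
    simpa using hν'.sub (hν.const_mul s)
  have h1 := (h0.zero_mul_isBoundedUnder_le
    (isBoundedUnder_of_eventually_le (f := l) (u := norm ∘ fun x : ℝ => μ x * Complex.exp (s * x))
      hC)).sub (hL.mul hν)
  have h2 : Tendsto (fun _ : ℝ => W) l (nhds (0 - L * 1)) := by
    refine h1.congr fun x => ?_
    have he : Complex.exp (-s * x) * Complex.exp (s * x) = 1 := by
      rw [← Complex.exp_add]; simp
    rw [← hW x]
    linear_combination (μ x * deriv ν x - deriv μ x * ν x) * he
  simpa using tendsto_nhds_unique tendsto_const_nhds h2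

/-- The Jost solution at `+∞` satisfies `2 t + ∫ exp (t y) V μ = W`, with `W` the Wronskian. -/
lemma wronskian_eq_integral_atTop {t lam : ℂ} (ht : 0 < t.re) (hlam : lam = -t ^ 2)
    {V μp μm : ℝ → ℂ} (hμp : ContDiff ℝ 2 μp) (hμm : ContDiff ℝ 2 μm)
    (hodep : ∀ x : ℝ, deriv (deriv μp) x + (lam - V x) * μp x = 0)
    (hodem : ∀ x : ℝ, deriv (deriv μm) x + (lam - V x) * μm x = 0)
    (hasymp : Tendsto (fun x : ℝ => μp x * Complex.exp (t * x)) atTop (nhds 1))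
    (hasymp' : Tendsto (fun x : ℝ => deriv μp x * Complex.exp (t * x)) atTop (nhds (-t)))
    (hasymm : Tendsto (fun x : ℝ => μm x * Complex.exp (-t * x)) atBot (nhds 1))
    (hasymm' : Tendsto (fun x : ℝ => deriv μm x * Complex.exp (-t * x)) atBot (nhds t))
    (hintpp : Integrable (fun y : ℝ => Complex.exp (t * y) * V y * μp y))
    (hintpm : Integrable (fun y : ℝ => Complex.exp (-t * y) * V y * μp y))
    (heqp : ∀ x : ℝ, μp x = Complex.exp (-t * x)
      - (1 / (2 * t)) * (∫ y in Ici x, Complex.exp (-t * ((y : ℂ) - (x : ℂ))) * V y * μp y)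
      + (1 / (2 * t)) * (∫ y in Ici x, Complex.exp (t * ((y : ℂ) - (x : ℂ))) * V y * μp y)) :
    2 * t + ∫ y : ℝ, Complex.exp (t * y) * V y * μp y
      = μp 0 * deriv μm 0 - deriv μp 0 * μm 0 := by
  have hF := hasDerivAt_exp_mul_deriv_sub hlam hμp hodep
  have hbot := tendsto_limUnder_of_hasDerivAt_of_integrableOn_Iic (a := 0) (fun x _ => hF x)
    hintpp.integrableOn
  have htop : Tendsto (fun x : ℝ => Complex.exp (t * x) * (deriv μp x - t * μp x)) atTop
      (nhds (-t - t * 1)) :=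
    (hasymp'.sub (hasymp.const_mul t)).congr fun x => by ring
  have hI := integral_of_hasDerivAt_of_tendsto hF hintpp hbot htop
  have hW := wronskian_eq_neg_of_tendsto (wronskian_eq_wronskian_zero hμp hμm hodep hodem)
    hasymm hasymm' hbot ((eventually_le_atBot 0).mono fun x hx =>
      norm_mul_exp_le (c := -(1 / (2 * t))) (d := 1 / (2 * t)) (Ici x)
        (mul_nonpos_of_nonneg_of_nonpos ht.le hx) hintpp hintpm
        (by linear_combination heqp x))
  rw [hI, hW]
  ring

/-- The Jost solution at `-∞` satisfies `2 t + ∫ exp (-t y) V μ = W`, with `W` the Wronskian. -/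
lemma wronskian_eq_integral_atBot {t lam : ℂ} (ht : 0 < t.re) (hlam : lam = -t ^ 2)
    {V μp μm : ℝ → ℂ} (hμp : ContDiff ℝ 2 μp) (hμm : ContDiff ℝ 2 μm)
    (hodep : ∀ x : ℝ, deriv (deriv μp) x + (lam - V x) * μp x = 0)
    (hodem : ∀ x : ℝ, deriv (deriv μm) x + (lam - V x) * μm x = 0)
    (hasymp : Tendsto (fun x : ℝ => μp x * Complex.exp (t * x)) atTop (nhds 1))
    (hasymp' : Tendsto (fun x : ℝ => deriv μp x * Complex.exp (t * x)) atTop (nhds (-t)))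
    (hasymm : Tendsto (fun x : ℝ => μm x * Complex.exp (-t * x)) atBot (nhds 1))
    (hasymm' : Tendsto (fun x : ℝ => deriv μm x * Complex.exp (-t * x)) atBot (nhds t))
    (hintmp : Integrable (fun y : ℝ => Complex.exp (t * y) * V y * μm y))
    (hintmm : Integrable (fun y : ℝ => Complex.exp (-t * y) * V y * μm y))
    (heqm : ∀ x : ℝ, μm x = Complex.exp (t * x)
      + (1 / (2 * t)) * (∫ y in Iic x, Complex.exp (-t * ((y : ℂ) - (x : ℂ))) * V y * μm y)
      - (1 / (2 * t)) * (∫ y in Iic x, Complex.exp (t * ((y : ℂ) - (x : ℂ))) * V y * μm y)) :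
    2 * t + ∫ y : ℝ, Complex.exp (-t * y) * V y * μm y
      = μp 0 * deriv μm 0 - deriv μp 0 * μm 0 := by
  have hF := hasDerivAt_exp_mul_deriv_sub (s := -t) (by rw [hlam]; ring) hμm hodem
  have htop := tendsto_limUnder_of_hasDerivAt_of_integrableOn_Ioi (a := 0) (fun x _ => hF x)
    hintmm.integrableOn
  have hbot : Tendsto (fun x : ℝ => Complex.exp (-t * x) * (deriv μm x - -t * μm x)) atBot
      (nhds (t + t * 1)) :=
    (hasymm'.add (hasymm.const_mul t)).congr fun x => by ring
  have hI := integral_of_hasDerivAt_of_tendsto hF hintmm hbot htop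
  have hW := wronskian_eq_neg_of_tendsto (wronskian_eq_wronskian_zero hμm hμp hodem hodep)
    (by simpa only [neg_neg] using hasymp) (by simpa only [neg_neg] using hasymp') htop
    ((eventually_ge_atTop 0).mono fun x hx =>
      norm_mul_exp_le (c := -(1 / (2 * t))) (d := 1 / (2 * t)) (Iic x)
        (by rw [Complex.neg_re, neg_mul, neg_nonpos]; exact mul_nonneg ht.le hx) hintmm
        (by simpa only [neg_neg] using hintmp)
        (by simp only [neg_neg]; linear_combination heqm x))
  rw [hI]
  linear_combination hW

/-- With `Re t > 0`, `λ = -t²`, `V` continuous, and the Jost solutions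
`μ₊, μ₋` (C² solutions of `μ'' + (λ-V)μ = 0` with the stated asymptotics, integrability
and integral equations), the Evans function `E(λ) = μ₊(0)μ₋'(0) - μ₊'(0)μ₋(0)` satisfies
`𝔻(λ, μ₊, μ₋) = E(λ)²/(2t)`. -/
theorem statement8 (t : ℂ) (ht : 0 < t.re) (lam : ℂ) (hlam : lam = -t ^ 2)
    (V : ℝ → ℂ) (hV : Continuous V)
    (μp μm : ℝ → ℂ) (hμp : ContDiff ℝ 2 μp) (hμm : ContDiff ℝ 2 μm)
    (hodep : ∀ x : ℝ, deriv (deriv μp) x + (lam - V x) * μp x = 0)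
    (hodem : ∀ x : ℝ, deriv (deriv μm) x + (lam - V x) * μm x = 0)
    (hasymp : Tendsto (fun x : ℝ => μp x * Complex.exp (t * x)) atTop (nhds 1))
    (hasymp' : Tendsto (fun x : ℝ => deriv μp x * Complex.exp (t * x)) atTop (nhds (-t)))
    (hasymm : Tendsto (fun x : ℝ => μm x * Complex.exp (-t * x)) atBot (nhds 1))
    (hasymm' : Tendsto (fun x : ℝ => deriv μm x * Complex.exp (-t * x)) atBot (nhds t))
    (hintpp : Integrable (fun y : ℝ => Complex.exp (t * y) * V y * μp y))
    (hintpm : Integrable (fun y : ℝ => Complex.exp (-t * y) * V y * μp y))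
    (hintmp : Integrable (fun y : ℝ => Complex.exp (t * y) * V y * μm y))
    (hintmm : Integrable (fun y : ℝ => Complex.exp (-t * y) * V y * μm y))
    (heqp : ∀ x : ℝ, μp x = Complex.exp (-t * x)
      - (1 / (2 * t)) * (∫ y in Ici x, Complex.exp (-t * ((y : ℂ) - (x : ℂ))) * V y * μp y)
      + (1 / (2 * t)) * (∫ y in Ici x, Complex.exp (t * ((y : ℂ) - (x : ℂ))) * V y * μp y))
    (heqm : ∀ x : ℝ, μm x = Complex.exp (t * x)
      + (1 / (2 * t)) * (∫ y in Iic x, Complex.exp (-t * ((y : ℂ) - (x : ℂ))) * V y * μm y)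
      - (1 / (2 * t)) * (∫ y in Iic x, Complex.exp (t * ((y : ℂ) - (x : ℂ))) * V y * μm y)) :
    DD t V μp μm = (μp 0 * deriv μm 0 - deriv μp 0 * μm 0) ^ 2 / (2 * t) := by
  have ht0 : t ≠ 0 := fun h => by simp [h] at ht
  have hA := wronskian_eq_integral_atTop ht hlam hμp hμm hodep hodem hasymp hasymp' hasymm
    hasymm' hintpp hintpm heqp
  have hB := wronskian_eq_integral_atBot ht hlam hμp hμm hodep hodem hasymp hasymp' hasymm
    hasymm' hintmp hintmm heqm
  set E := μp 0 * deriv μm 0 - deriv μp 0 * μm 0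
  have hDp : D t V μp = fun x : ℝ => E / (2 * t) * Complex.exp (-t * x) := by
    ext x
    have hs := setIntegral_Ici_add_Iic hintpp x
    have hx := heqp x
    rw [← hA, ← hs]
    simp only [D, setIntegral_exp_mul_sub, neg_neg] at hx ⊢
    field_simp at hx ⊢
    linear_combination hx
  have hDm : D t V μm = fun x : ℝ => E / (2 * t) * Complex.exp (t * x) := by
    ext x
    have hs := setIntegral_Ici_add_Iic hintmm x
    have hx := heqm x
    rw [← hB, ← hs]
    simp only [D, setIntegral_exp_mul_sub, neg_neg] at hx ⊢
    field_simp at hx ⊢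
    linear_combination hx
  have hdp : deriv (D t V μp) 0 = E / (2 * t) * -t := by
    rw [hDp, ((hasDerivAt_exp_mul_ofReal (-t) 0).const_mul _).deriv]
    simp
  have hdm : deriv (D t V μm) 0 = E / (2 * t) * t := by
    rw [hDm, ((hasDerivAt_exp_mul_ofReal t 0).const_mul _).deriv]
    simp
  rw [DD, hdp, hdm, hDp, hDm]
  simp only [Complex.ofReal_zero, mul_zero, Complex.exp_zero, mul_one]
  field_simp
  ring
end

section
/- Let t ∈ ℂ with Re t > 0, λ = −t², and let V : ℝ → ℂ be continuous. Let μ₊, μ₋ be Jost solutions as follows: twice continuously differentiable solutions of μ'' + (λ − V(x))μ = 0 with (μ₊, μ₊')e^{tx} → (1, −t) as x → +∞ and (μ₋, μ₋')e^{−tx} → (1, t) as x → −∞, satisfying the integral equations μ₊(x) = e^{−tx} − (1/(2t))∫_x^∞ e^{−t(y−x)}V(y)μ₊(y) dy + (1/(2t))∫_x^∞ e^{t(y−x)}V(y)μ₊(y) dy and μ₋(x) = e^{tx} + (1/(2t))∫_{−∞}^x e^{−t(y−x)}V(y)μ₋(y) dy − (1/(2t))∫_{−∞}^x e^{t(y−x)}V(y)μ₋(y)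 dy, with y ↦ e^{±ty}V(y)μ_±(y) integrable on ℝ. Let ν₁, ν₂ be twice continuously differentiable solutions of the same equation with ν₁(0) = 1, ν₁'(0) = 0, ν₂(0) = 0, ν₂'(0) = 1, such that y ↦ e^{−ty}V(y)νᵢ(y) is integrable on [x,∞) and y ↦ e^{ty}V(y)νᵢ(y) is integrable on (−∞,x] for every x. Let E(λ) = μ₊(0)μ₋'(0) − μ₊'(0)μ₋(0) be the Evans function. Then 𝔻(λ, ν₁, ν₂) = E(λ)/(2t). -/
open MeasureTheory Set Filter

open Topology

/-- If `e^{-tx} (ν' + t ν)` is bounded on `[0, ∞)`, then so is `e^{-tx} ν`. -/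
lemma exists_norm_exp_neg_mul_le {t : ℂ} (ht : 0 < t.re) {ν ν' : ℝ → ℂ}
    (hν : ∀ x, HasDerivAt ν (ν' x) x) {M : ℝ}
    (hM : ∀ x : ℝ, 0 ≤ x → ‖Complex.exp (-t * x) * (ν' x + t * ν x)‖ ≤ M) :
    ∃ C : ℝ, ∀ x : ℝ, 0 ≤ x → ‖Complex.exp (-t * x) * ν x‖ ≤ C := by
  have hM0 : 0 ≤ M := (norm_nonneg _).trans (hM 0 le_rfl)
  have hexp : ∀ x : ℝ, HasDerivAt (fun y : ℝ => Complex.exp (t * y)) (Complex.exp (t * x) * t) x := by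
    intro x
    simpa using ((Complex.ofRealCLM.hasDerivAt (x := x)).const_mul t).cexp
  have hF : ∀ x : ℝ, HasDerivAt (fun y : ℝ => Complex.exp (t * y) * ν y)
      (Complex.exp (t * x) * (ν' x + t * ν x)) x := fun x =>
    ((hexp x).mul (hν x)).congr_deriv (by ring)
  have hB : ∀ x : ℝ, HasDerivAt
      (fun y : ℝ => ‖ν 0‖ + M / (2 * t.re) * Real.exp (2 * t.re * y))
      (M * Real.exp (2 * t.re * x)) x := by
    intro x
    have h := ((((hasDerivAt_id x).const_mul (2 * t.re)).exp).const_mul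
      (M / (2 * t.re))).const_add ‖ν 0‖
    refine h.congr_deriv ?_
    simp only [id]
    field_simp
  refine ⟨‖ν 0‖ + M / (2 * t.re), fun x hx => ?_⟩
  have key : ‖Complex.exp (t * x) * ν x‖ ≤ ‖ν 0‖ + M / (2 * t.re) * Real.exp (2 * t.re * x) := by
    refine image_norm_le_of_norm_deriv_right_le_deriv_boundary
      (f := fun y : ℝ => Complex.exp (t * y) * ν y) (a := 0) (b := x)
      (fun y _ => (hF y).continuousAt.continuousWithinAt)
      (fun y _ => (hF y).hasDerivWithinAt) ?_ hB ?_ ⟨hx, le_rfl⟩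
    · simp only [Complex.ofReal_zero, mul_zero, Complex.exp_zero, one_mul, Real.exp_zero, mul_one]
      have : 0 ≤ M / (2 * t.re) := by positivity
      linarith
    · intro y hy
      have h1 : Complex.exp (t * y) * (ν' y + t * ν y)
          = Complex.exp (2 * t * y) * (Complex.exp (-t * y) * (ν' y + t * ν y)) := by
        rw [← mul_assoc, ← Complex.exp_add]
        ring_nf
      have h2 : ‖Complex.exp (2 * t * y)‖ = Real.exp (2 * t.re * y) := by
        simp [Complex.norm_exp]
      rw [h1, norm_mul, h2, mul_comm]
      exact mul_le_mul_of_nonneg_right (hM y hy.1) (Real.exp_pos _).le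
  have h1 : Complex.exp (-t * x) * ν x
      = Complex.exp (-(2 * t * x)) * (Complex.exp (t * x) * ν x) := by
    rw [← mul_assoc, ← Complex.exp_add]
    ring_nf
  have h2 : ‖Complex.exp (-(2 * t * x))‖ = Real.exp (-(2 * t.re * x)) := by
    simp [Complex.norm_exp]
  have h3 : Real.exp (-(2 * t.re * x)) ≤ 1 := by
    rw [Real.exp_le_one_iff]
    have : 0 ≤ 2 * t.re * x := by positivity
    linarith
  have h4 : Real.exp (-(2 * t.re * x)) * Real.exp (2 * t.re * x) = 1 := by
    rw [← Real.exp_add]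
    simp
  rw [h1, norm_mul, h2]
  calc _ ≤ Real.exp (-(2 * t.re * x)) * (‖ν 0‖ + M / (2 * t.re) * Real.exp (2 * t.re * x)) := by
        gcongr
    _ = Real.exp (-(2 * t.re * x)) * ‖ν 0‖ + M / (2 * t.re) := by
        linear_combination M / (2 * t.re) * h4
    _ ≤ _ := by
        have := mul_le_mul_of_nonneg_right h3 (norm_nonneg (ν 0))
        linarith

/-- The integral of `e^{-ty} V ν` over the half-line, through the Wronskian of `ν` with the
solution `μ` that decays like `e^{-tx}`. -/
lemma integral_exp_neg_mul_eq_wronskian {t : ℂ} (ht : 0 < t.re) {V μ μ' ν ν' : ℝ → ℂ}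
    (hμ : ∀ x, HasDerivAt μ (μ' x) x) (hμ' : ∀ x, HasDerivAt μ' ((t ^ 2 + V x) * μ x) x)
    (hν : ∀ x, HasDerivAt ν (ν' x) x) (hν' : ∀ x, HasDerivAt ν' ((t ^ 2 + V x) * ν x) x)
    (hlim : Tendsto (fun x : ℝ => μ x * Complex.exp (t * x)) atTop (𝓝 1))
    (hlim' : Tendsto (fun x : ℝ => μ' x * Complex.exp (t * x)) atTop (𝓝 (-t)))
    (hint : IntegrableOn (fun y : ℝ => Complex.exp (-t * y) * V y * ν y) (Ioi 0)) :
    ∫ y in Ioi (0 : ℝ), Complex.exp (-t * y) * V y * ν y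
      = μ 0 * ν' 0 - μ' 0 * ν 0 - (ν' 0 + t * ν 0) := by
  set g : ℝ → ℂ := fun x => Complex.exp (-t * x) * (ν' x + t * ν x) with hg
  have hgd : ∀ x : ℝ, HasDerivAt g (Complex.exp (-t * x) * V x * ν x) x := by
    intro x
    have hexp : HasDerivAt (fun y : ℝ => Complex.exp (-t * y)) (Complex.exp (-t * x) * -t) x := by
      simpa using ((Complex.ofRealCLM.hasDerivAt (x := x)).const_mul (-t)).cexp
    exact (hexp.mul ((hν' x).add ((hν x).const_mul t))).congr_deriv
      (by simp only [Pi.add_apply]; ring)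
  have hgc : Continuous g := continuous_iff_continuousAt.2 fun x => (hgd x).continuousAt
  have hgl := tendsto_limUnder_of_hasDerivAt_of_integrableOn_Ioi (a := 0)
    (fun x _ => hgd x) hint
  set α := limUnder atTop g
  have hI := integral_Ioi_of_hasDerivAt_of_tendsto' (a := (0 : ℝ)) (fun x _ => hgd x) hint hgl
  obtain ⟨M, hM⟩ : ∃ M, ∀ x : ℝ, 0 ≤ x → ‖g x‖ ≤ M := by
    obtain ⟨N, hN⟩ := eventually_atTop.1 (hgl.norm.eventually_le_const (lt_add_one ‖α‖))
    obtain ⟨K, hK⟩ := (isCompact_Icc (a := (0 : ℝ)) (b := N)).exists_bound_of_continuousOn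
      hgc.continuousOn
    refine ⟨max K (‖α‖ + 1), fun x hx => ?_⟩
    rcases le_total x N with h | h
    · exact (hK x ⟨hx, h⟩).trans (le_max_left _ _)
    · exact (hN x h).trans (le_max_right _ _)
  obtain ⟨C, hC⟩ := exists_norm_exp_neg_mul_le ht hν hM
  have hW : ∀ x : ℝ, μ x * ν' x - μ' x * ν x = μ 0 * ν' 0 - μ' 0 * ν 0 := by
    have hd : ∀ x : ℝ, HasDerivAt (fun x => μ x * ν' x - μ' x * ν x) 0 x := fun x =>
      (((hμ x).mul (hν' x)).sub ((hμ' x).mul (hν x))).congr_deriv (by ring)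
    exact fun x => is_const_of_deriv_eq_zero (fun x => (hd x).differentiableAt)
      (fun x => (hd x).deriv) x 0
  have hz : Tendsto (fun x : ℝ => t * (μ x * Complex.exp (t * x)) + μ' x * Complex.exp (t * x))
      atTop (𝓝 0) := by
    simpa using (hlim.const_mul t).add hlim'
  have hzv := hz.zero_mul_isBoundedUnder_le (g := fun x : ℝ => Complex.exp (-t * x) * ν x)
    (isBoundedUnder_of_eventually_le (a := C)
      (by filter_upwards [eventually_ge_atTop 0] with x hx using hC x hx))
  have hlimW := (hlim.mul hgl).sub hzv
  rw [one_mul, sub_zero] at hlimW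
  have hWα : μ 0 * ν' 0 - μ' 0 * ν 0 = α := by
    refine tendsto_nhds_unique (tendsto_const_nhds (f := (atTop : Filter ℝ)))
      (hlimW.congr fun x => ?_)
    rw [← hW x]
    have he : Complex.exp (t * x) * Complex.exp (-t * x) = 1 := by
      rw [← Complex.exp_add]
      simp
    simp only [hg]
    linear_combination (μ x * ν' x - μ' x * ν x) * he
  rw [hI, hWα]
  simp [hg]

/-- The counterpart of `integral_exp_neg_mul_eq_wronskian` on the left half-line. -/
lemma integral_exp_mul_eq_wronskian {t : ℂ} (ht : 0 < t.re) {V μ μ' ν ν' : ℝ → ℂ}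
    (hμ : ∀ x, HasDerivAt μ (μ' x) x) (hμ' : ∀ x, HasDerivAt μ' ((t ^ 2 + V x) * μ x) x)
    (hν : ∀ x, HasDerivAt ν (ν' x) x) (hν' : ∀ x, HasDerivAt ν' ((t ^ 2 + V x) * ν x) x)
    (hlim : Tendsto (fun x : ℝ => μ x * Complex.exp (-t * x)) atBot (𝓝 1))
    (hlim' : Tendsto (fun x : ℝ => μ' x * Complex.exp (-t * x)) atBot (𝓝 t))
    (hint : IntegrableOn (fun y : ℝ => Complex.exp (t * y) * V y * ν y) (Iic 0)) :
    ∫ y in Iic (0 : ℝ), Complex.exp (t * y) * V y * ν y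
      = μ' 0 * ν 0 - μ 0 * ν' 0 + (ν' 0 - t * ν 0) := by
  have hrefl : ∀ {f f' : ℝ → ℂ}, (∀ x, HasDerivAt f (f' x) x) →
      ∀ x, HasDerivAt (fun y => f (-y)) (-f' (-x)) x := fun hf x => by
    simpa [Function.comp_def] using (hf (-x)).scomp x (hasDerivAt_neg x)
  have hneg : ∀ {f f' : ℝ → ℂ}, (∀ x, HasDerivAt f (f' x) x) →
      ∀ x, HasDerivAt (fun y => -f (-y)) (f' (-x)) x := fun hf x => by
    simpa using (hrefl hf x).fun_neg
  have h := integral_exp_neg_mul_eq_wronskian ht (V := fun x => V (-x))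
    (hrefl hμ) (hneg hμ') (hrefl hν) (hneg hν')
    (by simpa [Function.comp_def] using hlim.comp tendsto_neg_atTop_atBot)
    (by simpa [Function.comp_def] using (hlim'.comp tendsto_neg_atTop_atBot).neg)
    (by
      have h := IntegrableOn.comp_neg_Ici (c := (0 : ℝ)) (by simpa using hint)
      simpa using h.mono_set Ioi_subset_Ici_self)
  have h2 := integral_comp_neg_Ioi (0 : ℝ) (fun y : ℝ => Complex.exp (t * y) * V y * ν y)
  simp only [Complex.ofReal_neg, mul_neg, neg_zero, neg_mul] at h h2
  rw [← h2, h]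
  ring

lemma D_eq_exp_mul (t : ℂ) (V μ : ℝ → ℂ) (x : ℝ) :
    D t V μ x = μ x
      + 1 / (2 * t) * (Complex.exp (t * x) * ∫ y in Ioi x, Complex.exp (-t * y) * V y * μ y)
      + 1 / (2 * t) * (Complex.exp (-t * x) * ∫ y in Iic x, Complex.exp (t * y) * V y * μ y) := by
  have h : ∀ (s : ℂ) (y : ℝ), Complex.exp (s * ((y : ℂ) - x)) * V y * μ y
      = Complex.exp (-s * x) * (Complex.exp (s * y) * V y * μ y) := fun s y => by
    rw [← mul_assoc, ← mul_assoc, ← Complex.exp_add]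
    ring_nf
  simp only [D, h, integral_const_mul, integral_Ici_eq_integral_Ioi, neg_neg]

lemma hasDerivAt_integral_Iic {f : ℝ → ℂ} (hf : Continuous f)
    (hint : ∀ x, IntegrableOn f (Iic x)) (x : ℝ) :
    HasDerivAt (fun x => ∫ y in Iic x, f y) (f x) x := by
  have h := (intervalIntegral.integral_hasDerivAt_right (hf.intervalIntegrable 0 x)
    (hf.stronglyMeasurableAtFilter _ _) hf.continuousAt).add_const (∫ y in Iic 0, f y)
  refine h.congr_of_eventuallyEq (Eventually.of_forall fun z => ?_)
  simp only [← intervalIntegral.integral_Iic_sub_Iic (hint 0) (hint z), sub_add_cancel]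

lemma hasDerivAt_integral_Ioi {f : ℝ → ℂ} (hf : Continuous f)
    (hint : ∀ x, IntegrableOn f (Ioi x)) (x : ℝ) :
    HasDerivAt (fun x => ∫ y in Ioi x, f y) (-f x) x := by
  have h := (intervalIntegral.integral_hasDerivAt_right (hf.intervalIntegrable 0 x)
    (hf.stronglyMeasurableAtFilter _ _) hf.continuousAt).const_sub (∫ y in Ioi 0, f y)
  refine h.congr_of_eventuallyEq (Eventually.of_forall fun z => ?_)
  simp only [← intervalIntegral.integral_Ioi_sub_Ioi' (hint 0) (hint z), sub_sub_cancel]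

lemma deriv_D_zero {t : ℂ} (ht : t ≠ 0) {V μ μ' : ℝ → ℂ} (hV : Continuous V)
    (hμ : ∀ x, HasDerivAt μ (μ' x) x)
    (hintp : ∀ x : ℝ, IntegrableOn (fun y : ℝ => Complex.exp (-t * y) * V y * μ y) (Ici x))
    (hintm : ∀ x : ℝ, IntegrableOn (fun y : ℝ => Complex.exp (t * y) * V y * μ y) (Iic x)) :
    deriv (D t V μ) 0 = μ' 0 + ((∫ y in Ioi (0 : ℝ), Complex.exp (-t * y) * V y * μ y)
      - ∫ y in Iic (0 : ℝ), Complex.exp (t * y) * V y * μ y) / 2 := by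
  have hμc : Continuous μ := continuous_iff_continuousAt.2 fun x => (hμ x).continuousAt
  have hexp : ∀ s : ℂ, HasDerivAt (fun y : ℝ => Complex.exp (s * y)) s 0 := fun s => by
    simpa using ((Complex.ofRealCLM.hasDerivAt (x := 0)).const_mul s).cexp
  have hA := hasDerivAt_integral_Ioi
    (f := fun y : ℝ => Complex.exp (-t * y) * V y * μ y) (by fun_prop)
    (fun x => (hintp x).mono_set Ioi_subset_Ici_self) 0
  have hB := hasDerivAt_integral_Iic
    (f := fun y : ℝ => Complex.exp (t * y) * V y * μ y) (by fun_prop) hintm 0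
  have h := ((hμ 0).add (((hexp t).mul hA).const_mul (1 / (2 * t)))).add
    (((hexp (-t)).mul hB).const_mul (1 / (2 * t)))
  rw [funext (D_eq_exp_mul t V μ)]
  refine (h.congr_deriv ?_).deriv
  simp only [Complex.ofReal_zero, mul_zero, Complex.exp_zero, one_mul]
  field_simp
  ring

lemma hasDerivAt_and_hasDerivAt_deriv {t lam : ℂ} (hlam : lam = -t ^ 2) {V f : ℝ → ℂ}
    (hf : ContDiff ℝ 2 f) (hode : ∀ x : ℝ, deriv (deriv f) x + (lam - V x) * f x = 0) :
    (∀ x, HasDerivAt f (deriv f x) x) ∧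
      ∀ x, HasDerivAt (deriv f) ((t ^ 2 + V x) * f x) x := by
  have hf' : ContDiff ℝ 1 (deriv f) :=
    ((contDiff_succ_iff_deriv (n := 1)).1 (by simpa [one_add_one_eq_two] using hf)).2.2
  refine ⟨fun x => (hf.differentiable (by norm_num) x).hasDerivAt, fun x => ?_⟩
  refine (hf'.differentiable (by norm_num) x).hasDerivAt.congr_deriv ?_
  linear_combination hode x - f x * hlam

/-- With `Re t > 0`, `λ = -t²`, `V` continuous, Jost solutions `μ₊, μ₋`
as in Statement 8, and `ν₁, ν₂` the C² solutions of the same equation with initial data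
`ν₁(0) = 1, ν₁'(0) = 0, ν₂(0) = 0, ν₂'(0) = 1` satisfying the integrability conditions,
the Evans function `E(λ) = μ₊(0)μ₋'(0) - μ₊'(0)μ₋(0)` satisfies
`𝔻(λ, ν₁, ν₂) = E(λ)/(2t)`. -/
theorem statement9 (t : ℂ) (ht : 0 < t.re) (lam : ℂ) (hlam : lam = -t ^ 2)
    (V : ℝ → ℂ) (hV : Continuous V)
    (μp μm : ℝ → ℂ) (hμp : ContDiff ℝ 2 μp) (hμm : ContDiff ℝ 2 μm)
    (hodep : ∀ x : ℝ, deriv (deriv μp) x + (lam - V x) * μp x = 0)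
    (hodem : ∀ x : ℝ, deriv (deriv μm) x + (lam - V x) * μm x = 0)
    (hasymp : Tendsto (fun x : ℝ => μp x * Complex.exp (t * x)) atTop (nhds 1))
    (hasymp' : Tendsto (fun x : ℝ => deriv μp x * Complex.exp (t * x)) atTop (nhds (-t)))
    (hasymm : Tendsto (fun x : ℝ => μm x * Complex.exp (-t * x)) atBot (nhds 1))
    (hasymm' : Tendsto (fun x : ℝ => deriv μm x * Complex.exp (-t * x)) atBot (nhds t))
    (hintpp : Integrable (fun y : ℝ => Complex.exp (t * y) * V y * μp y))
    (hintpm : Integrable (fun y : ℝ => Complex.exp (-t * y) * V y * μp y))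
    (hintmp : Integrable (fun y : ℝ => Complex.exp (t * y) * V y * μm y))
    (hintmm : Integrable (fun y : ℝ => Complex.exp (-t * y) * V y * μm y))
    (heqp : ∀ x : ℝ, μp x = Complex.exp (-t * x)
      - (1 / (2 * t)) * (∫ y in Ici x, Complex.exp (-t * ((y : ℂ) - (x : ℂ))) * V y * μp y)
      + (1 / (2 * t)) * (∫ y in Ici x, Complex.exp (t * ((y : ℂ) - (x : ℂ))) * V y * μp y))
    (heqm : ∀ x : ℝ, μm x = Complex.exp (t * x)
      + (1 / (2 * t)) * (∫ y in Iic x, Complex.exp (-t * ((y : ℂ) - (x : ℂ))) * V y * μm y)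
      - (1 / (2 * t)) * (∫ y in Iic x, Complex.exp (t * ((y : ℂ) - (x : ℂ))) * V y * μm y))
    (ν₁ ν₂ : ℝ → ℂ) (hν₁ : ContDiff ℝ 2 ν₁) (hν₂ : ContDiff ℝ 2 ν₂)
    (hodeν₁ : ∀ x : ℝ, deriv (deriv ν₁) x + (lam - V x) * ν₁ x = 0)
    (hodeν₂ : ∀ x : ℝ, deriv (deriv ν₂) x + (lam - V x) * ν₂ x = 0)
    (hinit₁ : ν₁ 0 = 1 ∧ deriv ν₁ 0 = 0) (hinit₂ : ν₂ 0 = 0 ∧ deriv ν₂ 0 = 1)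
    (hintν₁p : ∀ x : ℝ, IntegrableOn (fun y : ℝ => Complex.exp (-t * y) * V y * ν₁ y) (Ici x))
    (hintν₁m : ∀ x : ℝ, IntegrableOn (fun y : ℝ => Complex.exp (t * y) * V y * ν₁ y) (Iic x))
    (hintν₂p : ∀ x : ℝ, IntegrableOn (fun y : ℝ => Complex.exp (-t * y) * V y * ν₂ y) (Ici x))
    (hintν₂m : ∀ x : ℝ, IntegrableOn (fun y : ℝ => Complex.exp (t * y) * V y * ν₂ y) (Iic x)) :
    DD t V ν₁ ν₂ = (μp 0 * deriv μm 0 - deriv μp 0 * μm 0) / (2 * t) := by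
  have ht0 : t ≠ 0 := fun h => by simp [h] at ht
  obtain ⟨hp, hp'⟩ := hasDerivAt_and_hasDerivAt_deriv hlam hμp hodep
  obtain ⟨hm, hm'⟩ := hasDerivAt_and_hasDerivAt_deriv hlam hμm hodem
  obtain ⟨h1, h1'⟩ := hasDerivAt_and_hasDerivAt_deriv hlam hν₁ hodeν₁
  obtain ⟨h2, h2'⟩ := hasDerivAt_and_hasDerivAt_deriv hlam hν₂ hodeν₂
  rw [DD, deriv_D_zero ht0 hV h1 hintν₁p hintν₁m, deriv_D_zero ht0 hV h2 hintν₂p hintν₂m,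
    D_eq_exp_mul, D_eq_exp_mul,
    integral_exp_neg_mul_eq_wronskian ht hp hp' h1 h1' hasymp hasymp'
      ((hintν₁p 0).mono_set Ioi_subset_Ici_self),
    integral_exp_neg_mul_eq_wronskian ht hp hp' h2 h2' hasymp hasymp'
      ((hintν₂p 0).mono_set Ioi_subset_Ici_self),
    integral_exp_mul_eq_wronskian ht hm hm' h1 h1' hasymm hasymm' (hintν₁m 0),
    integral_exp_mul_eq_wronskian ht hm hm' h2 h2' hasymm hasymm' (hintν₂m 0),
    hinit₁.1, hinit₁.2, hinit₂.1, hinit₂.2]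
  simp only [Complex.ofReal_zero, mul_zero, Complex.exp_zero]
  field_simp
  ring
end
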